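/- Let A ∈ 𝓡 and suppose the random vector X in [0,∞)^d has independent components X₁, X₂ (d = 2) with distributions F₁, F₂ ∈ 𝒮* and A = {x : x₁/2 + x₂/2 > 1}. Then F ∈ 𝒮*_A if and only if F₁ * F₂ ∈ 𝒮*; in particular since 𝒮* is not closed under convolution, there exist F₁, F₂ ∈ 𝒮* with F ∉ 𝒮*_A. -/

import Mathlib

open MeasureTheory ProbabilityTheory Filter Set Pointwise Asymptotics

/-- A set `A ⊆ ℝ^d` is increasing if `x ∈ A` and `y ≥ 0` componentwise imply `x + y ∈ A`. -/
def IncreasingSet {d : ℕ} (A : Set (Fin d → ℝ)) : Prop :=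
  ∀ x ∈ A, ∀ y : Fin d → ℝ, (∀ i, 0 ≤ y i) → x + y ∈ A

/-- The family 𝓡 of open increasing sets with convex complement and `0 ∉ closure A`. -/
def MemR {d : ℕ} (A : Set (Fin d → ℝ)) : Prop :=
  IsOpen A ∧ IncreasingSet A ∧ Convex ℝ Aᶜ ∧ (0 : Fin d → ℝ) ∉ closure A

/-- `P[X ∈ x·A]`. -/
noncomputable def probIn {d : ℕ} {Ω : Type*} [MeasurableSpace Ω] (P : Measure Ω)
    (X : Ω → (Fin d → ℝ)) (A : Set (Fin d → ℝ)) (x : ℝ) : ℝ :=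
  (P {ω | X ω ∈ x • A}).toReal

/-- `Y_A = sup{u > 0 : X ∈ u·A}`. -/
noncomputable def YA {d : ℕ} {Ω : Type*} (X : Ω → (Fin d → ℝ)) (A : Set (Fin d → ℝ))
    (ω : Ω) : ℝ :=
  sSup {u : ℝ | 0 < u ∧ X ω ∈ u • A}

/-- The tail of the distribution `F_A` of `Y_A`. -/
noncomputable def tailYA {d : ℕ} {Ω : Type*} [MeasurableSpace Ω] (P : Measure Ω)
    (X : Ω → (Fin d → ℝ)) (A : Set (Fin d → ℝ)) (x : ℝ) : ℝ :=
  (P {ω | x < YA X A ω}).toReal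

/-- A (positive) tail function is long-tailed: `T(x−a)/T(x) → 1` for every `a > 0`. -/
def LongTailedFun (T : ℝ → ℝ) : Prop :=
  (∀ x, 0 < T x) ∧ ∀ a > 0, Tendsto (fun x => T (x - a) / T x) atTop (nhds 1)

/-- The mean `μ_V = ∫₀^∞ V̄(y) dy` computed from the tail function. -/
noncomputable def tailMean (T : ℝ → ℝ) : ℝ := ∫ y in Ioi (0 : ℝ), T y

/-- Strong subexponentiality (class 𝒮*) of a tail function:
`∫₀^x T(x−y)T(y) dy ∼ 2 μ T(x)`, with `μ = ∫₀^∞ T < ∞` and `T > 0`. -/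
def StrongSubexpFun (T : ℝ → ℝ) : Prop :=
  (∀ x, 0 < T x) ∧ IntegrableOn T (Ioi 0) volume ∧
    Tendsto (fun x => (∫ y in (0 : ℝ)..x, T (x - y) * T y) / T x) atTop
      (nhds (2 * tailMean T))

/-- `V̄_u(x) = min(1, ∫_x^{x+u} V̄(y) dy)`. -/
noncomputable def tailU (T : ℝ → ℝ) (u x : ℝ) : ℝ := min 1 (∫ y in x..(x + u), T y)

/-- Strongly subexponential (class 𝒮_*): `V̄_u^{2*}(x)/V̄_u(x) → 2` uniformly in `u ∈ [1,∞)`,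
where `V̄_u^{2*}` is the tail of the sum of two independent random variables with tail `V̄_u`. -/
def StronglySubexpFun (T : ℝ → ℝ) : Prop :=
  (∀ x, 0 < T x) ∧ IntegrableOn T (Ioi 0) volume ∧
    ∀ ε > (0 : ℝ), ∃ x₀ : ℝ, ∀ u ≥ (1 : ℝ), ∀ x ≥ x₀,
      ∀ (Ω' : Type) (_ : MeasurableSpace Ω') (Q : Measure Ω'), IsProbabilityMeasure Q →
        ∀ Z₁ Z₂ : Ω' → ℝ, Measurable Z₁ → Measurable Z₂ → IndepFun Z₁ Z₂ Q →
          (∀ z, (Q {ω | z < Z₁ ω}).toReal = tailU T u z) →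
          (∀ z, (Q {ω | z < Z₂ ω}).toReal = tailU T u z) →
          |(Q {ω | x < Z₁ ω + Z₂ ω}).toReal / tailU T u x - 2| < ε

/-- Insensitivity function of a tail function. -/
def Insensitivity (T : ℝ → ℝ) (h : ℝ → ℝ) : Prop :=
  (∀ x, 0 < h x) ∧ Tendsto h atTop atTop ∧ Tendsto (fun x => h x / x) atTop (nhds 0) ∧
    Tendsto (fun x => T (x - h x) / T x) atTop (nhds 1) ∧
    Tendsto (fun x => T (x + h x) / T x) atTop (nhds 1)

/-- Generalized inverse of `h`. -/
noncomputable def geninv (h : ℝ → ℝ) (y : ℝ) : ℝ := sInf {x | 0 ≤ x ∧ y ≤ h x}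

namespace KLS

noncomputable def ramp (a b u : ℝ) : ℝ := max 0 (min 1 ((u - a) / b))

noncomputable def phiF (u : ℝ) : ℝ := 3 / 2 * ramp 1 2 u + 9 / 2 * ramp 12 4 u
noncomputable def phiG (u : ℝ) : ℝ := 3 * ramp 5 1 u + 3 * ramp 12 4 u

structure Good (φ : ℝ → ℝ) : Prop where
  mono : Monotone φ
  lip : ∀ x y, 0 ≤ y → φ x - φ (x - y) ≤ 3 * y
  zero : ∀ u ≤ 1, φ u = 0
  top : ∀ u, 16 ≤ u → φ u = 6
  shape : ∀ x y, 0 ≤ y → y ≤ x / 2 → φ x - φ (x - y) ≤ 9 / 10 * (4 + φ y)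

lemma ramp_nonneg (a b u : ℝ) : 0 ≤ ramp a b u := le_max_left _ _
lemma ramp_le (a b u : ℝ) : ramp a b u ≤ 1 := max_le zero_le_one (min_le_left _ _)
lemma ramp_zero {a b u : ℝ} (hb : 0 < b) (h : u ≤ a) : ramp a b u = 0 := by
  unfold ramp
  apply max_eq_left
  apply min_le_of_right_le
  exact div_nonpos_of_nonpos_of_nonneg (by linarith) hb.le
lemma ramp_one {a b u : ℝ} (hb : 0 < b) (h : a + b ≤ u) : ramp a b u = 1 := by
  unfold ramp
  have : 1 ≤ (u - a) / b := by rw [le_div_iff₀ hb]; linarith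
  rw [min_eq_left this]; norm_num
lemma ramp_mono {a b : ℝ} (hb : 0 < b) : Monotone (ramp a b) := by
  intro u v h
  unfold ramp
  gcongr
lemma ramp_lip {a b : ℝ} (hb : 0 < b) (x y : ℝ) (hy : 0 ≤ y) :
    ramp a b x - ramp a b (x - y) ≤ y / b := by
  unfold ramp
  have h : (x - y - a) / b = (x - a) / b - y / b := by ring
  have h0 : 0 ≤ y / b := by positivity
  rw [h]
  generalize (x - a) / b = s at *
  generalize y / b = t at *
  rcases max_cases 0 (min 1 s) with h1 | h1 <;> rcases max_cases 0 (min 1 (s - t)) with h2 | h2 <;>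
  rcases min_cases 1 s with h3 | h3 <;> rcases min_cases 1 (s - t) with h4 | h4 <;> linarith

lemma good_phiF : Good phiF := by
  have p2 : (0 : ℝ) < 2 := by norm_num
  have p4 : (0 : ℝ) < 4 := by norm_num
  refine ⟨?_, ?_, ?_, ?_, ?_⟩
  · intro x y h
    have := ramp_mono (a := 1) p2 h
    have := ramp_mono (a := 12) p4 h
    unfold phiF; linarith
  · intro x y hy
    have := ramp_lip (a := 1) p2 x y hy
    have := ramp_lip (a := 12) p4 x y hy
    unfold phiF; linarith
  · intro u hu
    unfold phiF; rw [ramp_zero p2 hu, ramp_zero p4 (by linarith)]; norm_num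
  · intro u hu
    unfold phiF; rw [ramp_one p2 (by linarith), ramp_one p4 (by linarith)]; norm_num
  · intro x y hy hyx
    have := ramp_lip (a := 12) p4 x y hy
    have := ramp_nonneg 1 2 y
    have := ramp_nonneg 1 2 (x - y)
    have := ramp_nonneg 12 4 y
    have := ramp_nonneg 12 4 (x - y)
    have := ramp_le 1 2 x
    have := ramp_le 12 4 x
    unfold phiF
    rcases le_or_gt x 12 with h | h
    · rw [ramp_zero p4 h]; linarith
    · rw [ramp_one (u := x) p2 (by linarith), ramp_one (u := x - y) p2 (by linarith)]
      rcases le_or_gt 3 y with h' | h'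
      · rw [ramp_one (u := y) p2 (by linarith)]; linarith
      · linarith

lemma good_phiG : Good phiG := by
  have p2 : (0 : ℝ) < 1 := by norm_num
  have p4 : (0 : ℝ) < 4 := by norm_num
  refine ⟨?_, ?_, ?_, ?_, ?_⟩
  · intro x y h
    have := ramp_mono (a := 5) p2 h
    have := ramp_mono (a := 12) p4 h
    unfold phiG; linarith
  · intro x y hy
    have h1 := ramp_lip (a := 5) p2 x y hy
    have h2 := ramp_lip (a := 12) p4 x y hy
    rcases le_or_gt x 12 with h | h
    · have := ramp_nonneg 12 4 (x - y)
      unfold phiG; rw [ramp_zero p4 h]; linarith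
    · rcases le_or_gt 6 (x - y) with h' | h'
      · unfold phiG
        rw [ramp_one (u := x) p2 (by linarith), ramp_one (u := x - y) p2 (by linarith)]; linarith
      · have := ramp_nonneg 12 4 (x - y)
        have := ramp_nonneg 5 1 (x - y)
        have := ramp_le 12 4 x
        have := ramp_le 5 1 x
        unfold phiG; linarith
  · intro u hu
    unfold phiG; rw [ramp_zero p2 (by linarith), ramp_zero p4 (by linarith)]; norm_num
  · intro u hu
    unfold phiG; rw [ramp_one p2 (by linarith), ramp_one p4 (by linarith)]; norm_num
  · intro x y hy hyx
    have := ramp_nonneg 5 1 y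
    have := ramp_nonneg 5 1 (x - y)
    have := ramp_nonneg 12 4 y
    have := ramp_nonneg 12 4 (x - y)
    have := ramp_le 5 1 x
    have := ramp_le 12 4 x
    unfold phiG
    rcases le_or_gt x 12 with h | h
    · rw [ramp_zero p4 h]; linarith
    · rw [ramp_one (u := x) p2 (by linarith), ramp_one (u := x - y) p2 (by linarith)]
      linarith

noncomputable def Q (φ : ℝ → ℝ) (x : ℝ) : ℝ := ∑' n : ℕ, (5 / 2 : ℝ) ^ n * φ (x / 1000 ^ n)

variable {φ : ℝ → ℝ}

lemma Good.nonneg (h : Good φ) (u : ℝ) : 0 ≤ φ u := by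
  rcases le_or_gt u 1 with h1 | h1
  · rw [h.zero u h1]
  · rw [← h.zero 1 le_rfl]; exact h.mono h1.le

lemma Good.le (h : Good φ) (u : ℝ) : φ u ≤ 3 * |u| := by
  rcases le_or_gt u 1 with h1 | h1
  · rw [h.zero u h1]; positivity
  · have := h.lip u u (by linarith)
    rw [sub_self, h.zero 0 (by norm_num)] at this
    rw [abs_of_pos (by linarith)]; linarith

lemma geo_summable (c : ℝ) : Summable (fun n : ℕ => c * (1 / 400 : ℝ) ^ n) :=
  (summable_geometric_of_lt_one (by norm_num) (by norm_num)).mul_left c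

lemma scale_eq (n : ℕ) (y : ℝ) :
    (5 / 2 : ℝ) ^ n * (3 * (y / 1000 ^ n)) = 3 * y * (1 / 400 : ℝ) ^ n := by
  have : (1 / 400 : ℝ) = (5 / 2) / 1000 := by norm_num
  rw [this, div_pow (5 / 2 : ℝ) 1000]; ring

lemma Good.summ (h : Good φ) (x : ℝ) :
    Summable (fun n : ℕ => (5 / 2 : ℝ) ^ n * φ (x / 1000 ^ n)) := by
  refine Summable.of_nonneg_of_le (fun n => mul_nonneg (by positivity) (h.nonneg _)) ?_
    (geo_summable (3 * |x|))
  intro n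
  rw [← scale_eq]
  gcongr
  have := h.le (x / 1000 ^ n)
  rwa [abs_div, abs_of_pos (by positivity : (0 : ℝ) < 1000 ^ n)] at this

lemma Good.Q_eq (h : Good φ) (x : ℝ) : Q φ x = φ x + 5 / 2 * Q φ (x / 1000) := by
  unfold Q
  rw [(h.summ x).tsum_eq_zero_add, ← tsum_mul_left]
  simp only [pow_zero, one_mul, div_one]
  congr 1
  apply tsum_congr
  intro n
  rw [pow_succ, pow_succ, div_div, mul_comm (1000 : ℝ)]; ring

lemma Good.Q_nonneg (h : Good φ) (x : ℝ) : 0 ≤ Q φ x :=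
  tsum_nonneg fun n => mul_nonneg (by positivity) (h.nonneg _)

lemma Good.Q_zero (h : Good φ) {x : ℝ} (hx : x ≤ 1) : Q φ x = 0 := by
  unfold Q
  convert tsum_zero with n
  rw [h.zero, mul_zero]
  rw [div_le_one (by positivity)]
  exact hx.trans (one_le_pow₀ (by norm_num))

lemma Good.Q_small (h : Good φ) {x : ℝ} (hx : x ≤ 1000) : Q φ x = φ x := by
  rw [h.Q_eq, h.Q_zero (by linarith)]; ring

lemma Good.Q_mono (h : Good φ) : Monotone (Q φ) := by
  intro x y hxy
  refine (h.summ x).tsum_le_tsum (fun n => ?_) (h.summ y)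
  gcongr
  apply h.mono
  gcongr

lemma Good.term (h : Good φ) (n : ℕ) (x y : ℝ) (hy : 0 ≤ y) :
    (5 / 2 : ℝ) ^ n * φ (x / 1000 ^ n) - (5 / 2 : ℝ) ^ n * φ ((x - y) / 1000 ^ n)
      ≤ 3 * y * (1 / 400) ^ n := by
  rw [← scale_eq, ← mul_sub]
  gcongr
  rw [sub_div]
  exact h.lip _ _ (by positivity)

lemma Good.Q_lip (h : Good φ) (x y : ℝ) (hy : 0 ≤ y) : Q φ x - Q φ (x - y) ≤ 4 * y := by
  unfold Q
  rw [← (h.summ x).tsum_sub (h.summ _)]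
  calc _ ≤ ∑' n : ℕ, 3 * y * (1 / 400 : ℝ) ^ n :=
        ((h.summ x).sub (h.summ _)).tsum_le_tsum (fun n => h.term n x y hy) (geo_summable _)
    _ = 3 * y * (1 - 1 / 400)⁻¹ := by
        rw [tsum_mul_left, tsum_geometric_of_lt_one (by norm_num) (by norm_num)]
    _ ≤ _ := by norm_num; linarith

lemma Good.Q_cont (h : Good φ) : Continuous (Q φ) := by
  have : LipschitzWith 4 (Q φ) := by
    apply LipschitzWith.of_le_add_mul
    intro x y
    rcases le_total x y with hxy | hxy
    · have := h.Q_mono hxy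
      have := dist_nonneg (x := x) (y := y)
      have : (0 : ℝ) ≤ ((4 : NNReal) : ℝ) * dist x y := by positivity
      linarith
    · have := h.Q_lip x (x - y) (by linarith)
      rw [sub_sub_cancel] at this
      rw [Real.dist_eq, abs_of_nonneg (by linarith)]
      push_cast; linarith
  exact this.continuous

lemma Good.Q_long (h : Good φ) (y : ℝ) (hy : 0 ≤ y) :
    Tendsto (fun x => Q φ x - Q φ (x - y)) atTop (nhds 0) := by
  have e : ∀ x, Q φ x - Q φ (x - y) = ∑' n : ℕ, ((5 / 2 : ℝ) ^ n * φ (x / 1000 ^ n) -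
      (5 / 2 : ℝ) ^ n * φ ((x - y) / 1000 ^ n)) := fun x => by
    unfold Q; rw [(h.summ x).tsum_sub (h.summ _)]
  simp_rw [e]
  rw [← tsum_zero (α := ℝ) (β := ℕ)]
  refine tendsto_tsum_of_dominated_convergence (geo_summable (3 * y)) ?_ ?_
  · intro n
    apply tendsto_const_nhds.congr'
    filter_upwards [eventually_ge_atTop (16 * 1000 ^ n + y)] with x hx
    have hp : (0 : ℝ) < 1000 ^ n := by positivity
    rw [h.top, h.top, sub_self]
    · rw [le_div_iff₀ hp]; linarith
    · rw [le_div_iff₀ hp]; linarith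
  · refine Eventually.of_forall fun x n => ?_
    rw [Real.norm_of_nonneg]
    · exact h.term n x y hy
    · rw [sub_nonneg]
      gcongr
      apply h.mono
      gcongr
      linarith

lemma Good.Q_scale (h : Good φ) {x : ℝ} (hx : 16 ≤ x) :
    Q φ x + 4 = 5 / 2 * (Q φ (x / 1000) + 4) := by
  rw [h.Q_eq x, h.top x hx]; ring

lemma Good.Q_scale_pow (h : Good φ) {u : ℝ} (hu : 1 / 10 ≤ u) (hu' : u ≤ 1000) (n : ℕ) :
    Q φ (1000 ^ n * u) + 4 = (5 / 2) ^ n * (φ u + 4) := by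
  induction n with
  | zero => simp [h.Q_small hu']
  | succ n ih =>
    have h1 : (1 : ℝ) ≤ 1000 ^ n := one_le_pow₀ (by norm_num)
    rw [h.Q_scale, pow_succ, pow_succ, show (1000 : ℝ) ^ n * 1000 * u / 1000 = 1000 ^ n * u by ring,
      ih]
    · ring
    · rw [pow_succ]; nlinarith

lemma Good.Q_sub_base (h : Good φ) {x y : ℝ} (hy : 0 ≤ y) (hy' : y ≤ 16) (hyx : y ≤ x / 2) :
    Q φ x - Q φ (x - y) ≤ 9 / 10 * (Q φ y + 4) := by
  rw [h.Q_small (x := y) (by linarith)]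
  rcases le_or_gt x 1000 with hx | hx
  · rw [h.Q_small hx, h.Q_small (by linarith)]
    linarith [h.shape x y hy hyx]
  · rw [h.Q_eq x, h.Q_eq (x - y), h.top x (by linarith), h.top (x - y) (by linarith), sub_div]
    have := h.Q_lip (x / 1000) (y / 1000) (by positivity)
    have := h.nonneg y
    linarith

lemma Good.Q_sub (h : Good φ) {x y : ℝ} (hy : 0 ≤ y) (hyx : y ≤ x / 2) :
    Q φ x - Q φ (x - y) ≤ 9 / 10 * (Q φ y + 4) := by
  obtain ⟨n, hn⟩ : ∃ n : ℕ, y ≤ 16 * 1000 ^ n := by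
    obtain ⟨n, hn⟩ := pow_unbounded_of_one_lt y (by norm_num : (1 : ℝ) < 1000)
    exact ⟨n, by linarith [(by positivity : (0 : ℝ) < 1000 ^ n)]⟩
  induction n generalizing x y with
  | zero => exact h.Q_sub_base hy (by simpa using hn) hyx
  | succ n ih =>
    rcases le_or_gt y 16 with h1 | h1
    · exact h.Q_sub_base hy h1 hyx
    · have := @ih (x / 1000) (y / 1000) (by positivity) (by linarith)
        (by rw [pow_succ] at hn; linarith)
      have e1 := h.Q_scale (x := x) (by linarith)
      have e2 := h.Q_scale (x := x - y) (by linarith)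
      have e3 := h.Q_scale (x := y) (by linarith)
      rw [sub_div] at e2
      linarith

lemma Good.Q_growth (h : Good φ) (y : ℝ) : y ≤ (Q φ y + 4) ^ 8 := by
  obtain ⟨n, hn⟩ : ∃ n : ℕ, y ≤ 16 * 1000 ^ n := by
    obtain ⟨n, hn⟩ := pow_unbounded_of_one_lt y (by norm_num : (1 : ℝ) < 1000)
    exact ⟨n, by linarith [(by positivity : (0 : ℝ) < 1000 ^ n)]⟩
  have base : ∀ y ≤ (16 : ℝ), y ≤ (Q φ y + 4) ^ 8 := by
    intro y hy
    have : (4 : ℝ) ^ 8 ≤ (Q φ y + 4) ^ 8 := by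
      gcongr
      linarith [h.Q_nonneg y]
    norm_num at this
    linarith
  induction n generalizing y with
  | zero => exact base y (by simpa using hn)
  | succ n ih =>
    rcases le_or_gt y 16 with h1 | h1
    · exact base y h1
    · have := ih (y / 1000) (by rw [pow_succ] at hn; linarith)
      rw [h.Q_scale h1.le, mul_pow]
      have : (0 : ℝ) < y / 1000 := by positivity
      norm_num
      linarith

lemma Good.integrable (h : Good φ) :
    IntegrableOn (fun y => Real.exp (-(1 / 10 * Q φ y))) (Ioi 0) volume := by
  set D : ℝ := 2 * 10 ^ 16 * (Nat.factorial 16 : ℝ) * Real.exp (4 / 10) with hD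
  have hint : IntegrableOn (fun y : ℝ => D * (1 + y ^ 2)⁻¹) (Ioi 0) volume :=
    (integrable_inv_one_add_sq.const_mul D).integrableOn
  refine Integrable.mono' hint ?_ ?_
  · have := h.Q_cont
    exact (by fun_prop : Continuous fun y => Real.exp (-(1 / 10 * Q φ y))).aestronglyMeasurable
  · filter_upwards [ae_restrict_mem measurableSet_Ioi] with y hy
    have hy : 0 < y := hy
    rw [Real.norm_of_nonneg (Real.exp_pos _).le]
    have hg := h.Q_growth y
    set q := Q φ y + 4 with hq
    have hq4 : 4 ≤ q := by linarith [h.Q_nonneg y]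
    have e1 := Real.pow_div_factorial_le_exp (q / 10) (by linarith) 16
    have e2 : y ^ 2 ≤ q ^ 16 := by
      calc y ^ 2 ≤ (q ^ 8) ^ 2 := by gcongr
        _ = q ^ 16 := by ring
    have e3 : 1 ≤ q ^ 16 := one_le_pow₀ (by linarith)
    have e4 : Real.exp (-(1 / 10 * Q φ y)) = Real.exp (4 / 10) * (Real.exp (q / 10))⁻¹ := by
      rw [← Real.exp_neg, ← Real.exp_add]; congr 1; rw [hq]; ring
    rw [e4, hD, ← div_eq_mul_inv, ← div_eq_mul_inv, div_le_div_iff₀ (Real.exp_pos _) (by positivity)]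
    rw [div_pow, div_div, div_le_iff₀ (by positivity)] at e1
    have e5 : 1 + y ^ 2 ≤ 2 * (Real.exp (q / 10) * (10 ^ 16 * (Nat.factorial 16 : ℝ))) := by
      linarith
    calc _ ≤ Real.exp (4 / 10) * (2 * (Real.exp (q / 10) * (10 ^ 16 * (Nat.factorial 16 : ℝ)))) := by
          gcongr
      _ = _ := by ring

noncomputable def T (φ : ℝ → ℝ) (x : ℝ) : ℝ := Real.exp (-Q φ x)

lemma Good.T_cont (h : Good φ) : Continuous (T φ) := by
  have := h.Q_cont
  unfold T; fun_prop

lemma half_eq {g : ℝ → ℝ} (hg : Continuous g) (x : ℝ) :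
    ∫ y in (0 : ℝ)..x, g (x - y) * g y = 2 * ∫ y in (0 : ℝ)..(x / 2), g (x - y) * g y := by
  have hc : Continuous fun y => g (x - y) * g y := by fun_prop
  rw [← intervalIntegral.integral_add_adjacent_intervals (b := x / 2)
    (hc.intervalIntegrable _ _) (hc.intervalIntegrable _ _)]
  have := intervalIntegral.integral_comp_sub_left (a := x / 2) (b := x)
    (fun y => g (x - y) * g y) x
  simp only [sub_sub_cancel, sub_self] at this
  rw [show x - x / 2 = x / 2 by ring] at this
  rw [two_mul, ← this]
  congr 1
  apply intervalIntegral.integral_congr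
  intro y _
  simp only; ring

lemma Good.strong (h : Good φ) : StrongSubexpFun (T φ) := by
  have hTc := h.T_cont
  have hQc := h.Q_cont
  have hI : IntegrableOn (T φ) (Ioi 0) volume := by
    refine Integrable.mono' h.integrable hTc.aestronglyMeasurable ?_
    refine Eventually.of_forall fun y => ?_
    rw [T, Real.norm_of_nonneg (Real.exp_pos _).le]
    apply Real.exp_le_exp.2
    linarith [h.Q_nonneg y]
  refine ⟨fun x => Real.exp_pos _, hI, ?_⟩
  have key : Tendsto (fun x => ∫ y in Ioi (0 : ℝ),
      (Iic (x / 2)).indicator (fun y => Real.exp (Q φ x - Q φ (x - y) - Q φ y)) y) atTop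
      (nhds (∫ y in Ioi (0 : ℝ), T φ y)) := by
    refine tendsto_integral_filter_of_dominated_convergence
      (fun y => Real.exp (18 / 5) * Real.exp (-(1 / 10 * Q φ y))) ?_ ?_
      (h.integrable.const_mul _) ?_
    · refine Eventually.of_forall fun x => ?_
      have : Continuous fun y => Real.exp (Q φ x - Q φ (x - y) - Q φ y) := by fun_prop
      exact (this.aestronglyMeasurable).indicator measurableSet_Iic
    · refine Eventually.of_forall fun x => ?_
      filter_upwards [ae_restrict_mem measurableSet_Ioi] with y hy
      have hy : 0 < y := hy
      by_cases hyx : y ∈ Iic (x / 2)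
      · rw [indicator_of_mem hyx, Real.norm_of_nonneg (Real.exp_pos _).le, ← Real.exp_add]
        apply Real.exp_le_exp.2
        linarith [h.Q_sub hy.le hyx]
      · rw [indicator_of_notMem hyx, norm_zero]; positivity
    · filter_upwards [ae_restrict_mem measurableSet_Ioi] with y hy
      have hy : 0 < y := hy
      have h1 : Tendsto (fun x => Real.exp (Q φ x - Q φ (x - y) - Q φ y)) atTop
          (nhds (Real.exp (0 - Q φ y))) :=
        (Real.continuous_exp.tendsto _).comp ((h.Q_long y hy.le).sub_const _)
      rw [zero_sub] at h1
      refine h1.congr' ?_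
      filter_upwards [eventually_ge_atTop (2 * y)] with x hx
      rw [indicator_of_mem]
      show y ≤ x / 2
      linarith
  refine (key.const_mul 2).congr' ?_
  filter_upwards [eventually_ge_atTop 0] with x hx
  rw [half_eq hTc, mul_div_assoc]
  congr 1
  rw [setIntegral_indicator measurableSet_Iic, intervalIntegral.integral_of_le (by linarith),
    ← integral_div]
  have : Ioi (0 : ℝ) ∩ Iic (x / 2) = Ioc 0 (x / 2) := rfl
  rw [this]
  congr 1
  ext y
  unfold T
  rw [← Real.exp_add, ← Real.exp_sub]
  congr 1
  ring

end KLS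

namespace KLS

variable {φ : ℝ → ℝ}

noncomputable def Good.stieltjes (h : Good φ) : StieltjesFunction ℝ where
  toFun x := 1 - T φ x
  mono' := fun x y hxy => by
    have : T φ y ≤ T φ x := Real.exp_le_exp.2 (neg_le_neg (h.Q_mono hxy))
    simp only; linarith
  right_continuous' := fun x => by
    have := h.T_cont
    exact (by fun_prop : Continuous fun x => 1 - T φ x).continuousWithinAt

lemma Good.Q_atTop (h : Good φ) : Tendsto (Q φ) atTop atTop := by
  rw [tendsto_atTop]
  intro b
  filter_upwards [eventually_ge_atTop ((|b| + 4) ^ 8)] with y hy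
  have h1 : (|b| + 4) ^ 8 ≤ (Q φ y + 4) ^ 8 := hy.trans (h.Q_growth y)
  have := le_of_pow_le_pow_left₀ (by norm_num) (by linarith [h.Q_nonneg y]) h1
  linarith [le_abs_self b]

lemma Good.T_zero (h : Good φ) {x : ℝ} (hx : x ≤ 1) : T φ x = 1 := by
  rw [T, h.Q_zero hx]; simp

lemma Good.st_bot (h : Good φ) : Tendsto h.stieltjes atBot (nhds 0) := by
  apply tendsto_const_nhds.congr'
  filter_upwards [eventually_le_atBot 0] with x hx
  show 0 = 1 - T φ x
  rw [h.T_zero (by linarith)]; ring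

lemma Good.st_top (h : Good φ) : Tendsto h.stieltjes atTop (nhds 1) := by
  have : Tendsto (T φ) atTop (nhds 0) := Real.tendsto_exp_neg_atTop_nhds_zero.comp h.Q_atTop
  have h2 := this.const_sub 1
  rw [sub_zero] at h2
  exact h2

lemma Good.prob (h : Good φ) : IsProbabilityMeasure h.stieltjes.measure :=
  h.stieltjes.isProbabilityMeasure h.st_bot h.st_top

lemma Good.tail (h : Good φ) (x : ℝ) : h.stieltjes.measure (Ioi x) = ENNReal.ofReal (T φ x) := by
  rw [h.stieltjes.measure_Ioi h.st_top]
  congr 1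
  show 1 - (1 - T φ x) = T φ x
  ring

lemma Good.tail_max (h : Good φ) (x : ℝ) :
    h.stieltjes.measure {t | x < max t 0} = ENNReal.ofReal (T φ x) := by
  rcases le_or_gt 0 x with hx | hx
  · rw [← h.tail]
    congr 1
    ext t
    simp [lt_max_iff, not_lt.2 hx]
  · have : {t : ℝ | x < max t 0} = univ := by
      ext t; simp [lt_max_iff, hx]
    have := h.prob
    rw [‹{t : ℝ | x < max t 0} = univ›, measure_univ, h.T_zero (by linarith)]; simp

lemma YA_eq {Ω : Type} (X₁ X₂ : Ω → ℝ) (h1 : ∀ ω, 0 ≤ X₁ ω) (h2 : ∀ ω, 0 ≤ X₂ ω) (ω : Ω) :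
    YA (fun ω => ![X₁ ω, X₂ ω]) {z : Fin 2 → ℝ | 1 < z 0 / 2 + z 1 / 2} ω
      = (X₁ ω + X₂ ω) / 2 := by
  have : {u : ℝ | 0 < u ∧ ![X₁ ω, X₂ ω] ∈ u • {z : Fin 2 → ℝ | 1 < z 0 / 2 + z 1 / 2}}
      = Ioo 0 ((X₁ ω + X₂ ω) / 2) := by
    ext u
    simp only [mem_ofPred_eq, mem_Ioo]
    refine and_congr_right fun hu => ?_
    rw [Set.mem_smul_set_iff_inv_smul_mem₀ hu.ne']
    simp only [mem_ofPred_eq, Pi.smul_apply, smul_eq_mul, Matrix.cons_val_zero, Matrix.cons_val_one]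
    rw [show u⁻¹ * X₁ ω / 2 + u⁻¹ * X₂ ω / 2 = ((X₁ ω + X₂ ω) / 2) / u by field_simp,
      one_lt_div hu]
  unfold YA
  rw [this]
  have h0 : 0 ≤ (X₁ ω + X₂ ω) / 2 := by linarith [h1 ω, h2 ω]
  rcases h0.eq_or_lt with h | h
  · rw [← h]; simp
  · exact csSup_Ioo h

lemma scale_strong {g : ℝ → ℝ} {c : ℝ} (hc : 0 < c) (h : StrongSubexpFun g) :
    StrongSubexpFun (fun x => g (c * x)) := by
  obtain ⟨h1, h2, h3⟩ := h
  refine ⟨fun x => h1 _, ?_, ?_⟩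
  · have := (integrableOn_Ioi_comp_mul_left_iff g 0 hc).2 (by simpa using h2)
    exact this
  · have hm : tailMean (fun x => g (c * x)) = c⁻¹ * tailMean g := by
      unfold tailMean
      rw [integral_comp_mul_left_Ioi g 0 hc]; simp
    rw [hm]
    have h4 := (h3.comp (tendsto_id.const_mul_atTop hc)).const_mul c⁻¹
    rw [show c⁻¹ * (2 * tailMean g) = 2 * (c⁻¹ * tailMean g) by ring] at h4
    refine h4.congr fun x => ?_
    simp only [Function.comp, id]
    rw [← mul_div_assoc]
    congr 1
    have := intervalIntegral.integral_comp_mul_left (a := 0) (b := x)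
      (fun y => g (c * x - y) * g y) hc.ne'
    rw [mul_zero, smul_eq_mul] at this
    rw [← this]
    simp only [mul_sub]

lemma scale_iff {g k : ℝ → ℝ} (hk : ∀ x, k x = g (2 * x)) :
    StrongSubexpFun k ↔ StrongSubexpFun g := by
  constructor
  · intro h
    have := scale_strong (c := 1 / 2) (by norm_num) h
    convert this using 2 with x
    rw [hk]; congr 1; ring
  · intro h
    have := scale_strong (c := 2) (by norm_num) h
    rwa [show k = fun x => g (2 * x) from funext hk]

lemma part1 (Ω : Type) [MeasurableSpace Ω] (P : Measure Ω) (X₁ X₂ : Ω → ℝ)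
    (h1 : ∀ ω, 0 ≤ X₁ ω) (h2 : ∀ ω, 0 ≤ X₂ ω) :
    StrongSubexpFun
            (tailYA P (fun ω => ![X₁ ω, X₂ ω])
              {z : Fin 2 → ℝ | 1 < z 0 / 2 + z 1 / 2}) ↔
          StrongSubexpFun (fun x => (P {ω | x < X₁ ω + X₂ ω}).toReal) := by
  apply scale_iff
  intro x
  unfold tailYA
  congr 2
  ext ω
  simp only [mem_ofPred_eq]
  rw [YA_eq X₁ X₂ h1 h2, lt_div_iff₀ (by norm_num), mul_comm]

lemma not_strong (Ω : Type) [MeasurableSpace Ω] (P : Measure Ω) [IsProbabilityMeasure P]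
    (X Y : Ω → ℝ) (hX : ∀ ω, 0 ≤ X ω) (hY : ∀ ω, 0 ≤ Y ω)
    (tX : ∀ x, P.real {ω | x < X ω} = T phiF x) (tY : ∀ x, P.real {ω | x < Y ω} = T phiG x)
    (tXY : ∀ x y, P.real {ω | x < X ω ∧ y < Y ω} = T phiF x * T phiG y) :
    ¬ StrongSubexpFun (fun x => (P {ω | x < X ω + Y ω}).toReal) := by
  have gF := good_phiF
  have gG := good_phiG
  set H : ℝ → ℝ := fun x => (P {ω | x < X ω + Y ω}).toReal with hH
  have hH' : ∀ x, H x = P.real {ω | x < X ω + Y ω} := fun x => rfl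
  rintro ⟨hpos, -, hlim⟩
  have HF : ∀ x, T phiF x ≤ H x := fun x => by
    rw [← tX, hH']
    apply measureReal_mono
    · intro ω hω
      have hω : x < X ω := hω
      show x < X ω + Y ω
      linarith [hY ω]
    · exact measure_ne_top _ _
  have HG : ∀ x, T phiG x ≤ H x := fun x => by
    rw [← tY, hH']
    apply measureReal_mono
    · intro ω hω
      have hω : x < Y ω := hω
      show x < X ω + Y ω
      linarith [hX ω]
    · exact measure_ne_top _ _
  have Hanti : Antitone H := fun x y hxy => by
    rw [hH', hH']
    apply measureReal_mono
    · intro ω hω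
      exact lt_of_le_of_lt hxy hω
    · exact measure_ne_top _ _
  have p1 : (0 : ℝ) < 1 := by norm_num
  have p2 : (0 : ℝ) < 2 := by norm_num
  have p4 : (0 : ℝ) < 4 := by norm_num
  -- values of the tails at the points `1000 ^ n * u`
  have sF : ∀ n : ℕ, ∀ u : ℝ, 1 / 10 ≤ u → u ≤ 1000 →
      T phiF (1000 ^ n * u) = Real.exp (4 - (5 / 2) ^ n * (phiF u + 4)) := by
    intro n u h1 h2
    rw [T, ← gF.Q_scale_pow h1 h2 n]; congr 1; ring
  have sG : ∀ n : ℕ, ∀ u : ℝ, 1 / 10 ≤ u → u ≤ 1000 →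
      T phiG (1000 ^ n * u) = Real.exp (4 - (5 / 2) ^ n * (phiG u + 4)) := by
    intro n u h1 h2
    rw [T, ← gG.Q_scale_pow h1 h2 n]; congr 1; ring
  have upper : ∀ n : ℕ, H (1000 ^ n * 16) ≤ 4 * Real.exp (8 - (5 / 2) ^ n * (19 / 2)) := by
    intro n
    have hK : (0 : ℝ) < 1000 ^ n := by positivity
    have hM : (0 : ℝ) < (5 / 2) ^ n := by positivity
    have hA : T phiF (1000 ^ n * (78 / 5)) ≤ Real.exp (8 - (5 / 2) ^ n * (19 / 2)) := by
      rw [sF n _ (by norm_num) (by norm_num)]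
      apply Real.exp_le_exp.2
      have : (19 / 2 : ℝ) ≤ phiF (78 / 5) + 4 := by
        unfold phiF ramp; norm_num
      nlinarith
    have hD : T phiG (1000 ^ n * (78 / 5)) ≤ Real.exp (8 - (5 / 2) ^ n * (19 / 2)) := by
      rw [sG n _ (by norm_num) (by norm_num)]
      apply Real.exp_le_exp.2
      have : (19 / 2 : ℝ) ≤ phiG (78 / 5) + 4 := by
        unfold phiG ramp; norm_num
      nlinarith
    have hB : T phiF (1000 ^ n * 3) * T phiG (1000 ^ n * (2 / 5))
        ≤ Real.exp (8 - (5 / 2) ^ n * (19 / 2)) := by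
      rw [sF n _ (by norm_num) (by norm_num), sG n _ (by norm_num) (by norm_num), ← Real.exp_add]
      apply Real.exp_le_exp.2
      have : (11 / 2 : ℝ) ≤ phiF 3 + 4 := by
        unfold phiF ramp; norm_num
      have : (4 : ℝ) ≤ phiG (2 / 5) + 4 := by linarith [gG.nonneg (2 / 5)]
      nlinarith
    have hC : T phiF (1000 ^ n * (2 / 5)) * T phiG (1000 ^ n * 13)
        ≤ Real.exp (8 - (5 / 2) ^ n * (19 / 2)) := by
      rw [sF n _ (by norm_num) (by norm_num), sG n _ (by norm_num) (by norm_num), ← Real.exp_add]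
      apply Real.exp_le_exp.2
      have : (11 / 2 : ℝ) ≤ phiG 13 + 4 := by
        unfold phiG ramp; norm_num
      have : (4 : ℝ) ≤ phiF (2 / 5) + 4 := by linarith [gF.nonneg (2 / 5)]
      nlinarith
    rw [← tX] at hA
    rw [← tY] at hD
    rw [← tXY] at hB hC
    have hsub : {ω | 1000 ^ n * 16 < X ω + Y ω} ⊆
        ({ω | 1000 ^ n * (78 / 5) < X ω} ∪ {ω | 1000 ^ n * (78 / 5) < Y ω}) ∪
        ({ω | 1000 ^ n * 3 < X ω ∧ 1000 ^ n * (2 / 5) < Y ω} ∪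
          {ω | 1000 ^ n * (2 / 5) < X ω ∧ 1000 ^ n * 13 < Y ω}) := by
      intro ω hω
      have hω : 1000 ^ n * 16 < X ω + Y ω := hω
      by_contra hcon
      simp only [mem_union, mem_ofPred_eq, not_or, not_and, not_lt] at hcon
      obtain ⟨⟨c1, c2⟩, c3, c4⟩ := hcon
      rcases lt_or_ge (1000 ^ n * 3) (X ω) with h | h
      · have := c3 h; linarith
      · have := c4 (by linarith); linarith
    rw [hH']
    have u1 := measureReal_mono (μ := P) hsub (measure_ne_top _ _)
    have u2 := measureReal_union_le (μ := P)
        ({ω | 1000 ^ n * (78 / 5) < X ω} ∪ {ω | 1000 ^ n * (78 / 5) < Y ω})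
        ({ω | 1000 ^ n * 3 < X ω ∧ 1000 ^ n * (2 / 5) < Y ω} ∪
          {ω | 1000 ^ n * (2 / 5) < X ω ∧ 1000 ^ n * 13 < Y ω})
    have u3 := measureReal_union_le (μ := P)
        {ω | 1000 ^ n * (78 / 5) < X ω} {ω | 1000 ^ n * (78 / 5) < Y ω}
    have u4 := measureReal_union_le (μ := P)
        {ω | 1000 ^ n * 3 < X ω ∧ 1000 ^ n * (2 / 5) < Y ω}
          {ω | 1000 ^ n * (2 / 5) < X ω ∧ 1000 ^ n * 13 < Y ω}
    linarith
  have lower : ∀ n : ℕ, 1000 ^ n * Real.exp (8 - (5 / 2) ^ n * (19 / 2)) ≤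
      ∫ y in (0 : ℝ)..(1000 ^ n * 16), H (1000 ^ n * 16 - y) * H y := by
    intro n
    have hK : (0 : ℝ) < 1000 ^ n := by positivity
    have hHm : Measurable H := Hanti.measurable
    have hH1 : ∀ x, H x ≤ 1 := fun x => by rw [hH']; exact measureReal_le_one
    have hint : ∀ a b, IntervalIntegrable (fun y => H (1000 ^ n * 16 - y) * H y) volume a b := by
      intro a b
      refine (intervalIntegrable_const (c := (1 : ℝ))).mono_fun' ?_ ?_
      · exact (by fun_prop : Measurable fun y => H (1000 ^ n * 16 - y) * H y).aestronglyMeasurable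
      · refine Eventually.of_forall fun y => ?_
        have h1 := hH1 (1000 ^ n * 16 - y)
        have h2 := hH1 y
        have h3 := hpos (1000 ^ n * 16 - y)
        have h4 := hpos y
        show ‖H (1000 ^ n * 16 - y) * H y‖ ≤ 1
        rw [Real.norm_of_nonneg (by positivity)]
        exact mul_le_one₀ h1 h4.le h2
    have hsub : ∫ y in (1000 ^ n * 4 : ℝ)..(1000 ^ n * 5), H (1000 ^ n * 16 - y) * H y ≤
        ∫ y in (0 : ℝ)..(1000 ^ n * 16), H (1000 ^ n * 16 - y) * H y := by
      apply intervalIntegral.integral_mono_interval (by positivity) (by linarith) (by linarith)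
      · refine Eventually.of_forall fun y => ?_
        exact mul_nonneg (hpos _).le (hpos _).le
      · exact hint _ _
    refine le_trans ?_ hsub
    have hc : ∫ y in (1000 ^ n * 4 : ℝ)..(1000 ^ n * 5), Real.exp (8 - (5 / 2) ^ n * (19 / 2))
        = 1000 ^ n * Real.exp (8 - (5 / 2) ^ n * (19 / 2)) := by
      rw [intervalIntegral.integral_const, smul_eq_mul]; ring
    rw [← hc]
    apply intervalIntegral.integral_mono_on (by linarith) intervalIntegrable_const (hint _ _)
    intro y hy
    have a1 : T phiF (1000 ^ n * 12) ≤ H (1000 ^ n * 16 - y) :=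
      (HF _).trans (Hanti (by linarith [hy.1]))
    have a2 : T phiG (1000 ^ n * 5) ≤ H y := (HG _).trans (Hanti hy.2)
    refine le_trans (le_of_eq ?_) (mul_le_mul a1 a2 (Real.exp_pos _).le (hpos _).le)
    rw [sF n _ (by norm_num) (by norm_num), sG n _ (by norm_num) (by norm_num), ← Real.exp_add]
    have e1 : phiF 12 = 3 / 2 := by unfold phiF ramp; norm_num
    have e2 : phiG 5 = 0 := by unfold phiG ramp; norm_num
    rw [e1, e2]; congr 1; ring
  have hp : Tendsto (fun n : ℕ => (1000 : ℝ) ^ n) atTop atTop :=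
    tendsto_pow_atTop_atTop_of_one_lt (by norm_num)
  have hx : Tendsto (fun n : ℕ => (1000 : ℝ) ^ n * 16) atTop atTop :=
    hp.atTop_mul_const (by norm_num)
  have l1 := hlim.comp hx
  have l2 : Tendsto (fun n : ℕ => (1000 : ℝ) ^ n * (1 / 4)) atTop atTop :=
    hp.atTop_mul_const (by norm_num)
  refine not_tendsto_nhds_of_tendsto_atTop (tendsto_atTop_mono ?_ l2) _ l1
  intro n
  simp only [Function.comp]
  have u := upper n
  have l := lower n
  rw [le_div_iff₀ (hpos _)]
  have hK : (0 : ℝ) < 1000 ^ n := by positivity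
  nlinarith

lemma T_nonneg (φ : ℝ → ℝ) (x : ℝ) : 0 ≤ T φ x := (Real.exp_pos _).le

lemma part2 : ∃ (Ω : Type) (_ : MeasurableSpace Ω) (P : Measure Ω) (_ : IsProbabilityMeasure P)
      (X₁ X₂ : Ω → ℝ), Measurable X₁ ∧ Measurable X₂ ∧
        (∀ ω, 0 ≤ X₁ ω) ∧ (∀ ω, 0 ≤ X₂ ω) ∧ IndepFun X₁ X₂ P ∧
        StrongSubexpFun (fun x => (P {ω | x < X₁ ω}).toReal) ∧
        StrongSubexpFun (fun x => (P {ω | x < X₂ ω}).toReal) ∧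
        ¬ StrongSubexpFun
            (tailYA P (fun ω => ![X₁ ω, X₂ ω])
              {z : Fin 2 → ℝ | 1 < z 0 / 2 + z 1 / 2}) := by
  have pF := good_phiF.prob
  have pG := good_phiG.prob
  set μ := good_phiF.stieltjes.measure with hμ
  set ν := good_phiG.stieltjes.measure with hν
  have hm : Measurable (fun t : ℝ => max t 0) := by fun_prop
  have tX : ∀ x, ((μ.prod ν) {ω : ℝ × ℝ | x < max ω.1 0}).toReal = T phiF x := by
    intro x
    have : {ω : ℝ × ℝ | x < max ω.1 0} = {t : ℝ | x < max t 0} ×ˢ univ := by ext ω; simp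
    rw [this, Measure.prod_prod, measure_univ, mul_one, hμ, good_phiF.tail_max,
      ENNReal.toReal_ofReal (T_nonneg _ _)]
  have tY : ∀ x, ((μ.prod ν) {ω : ℝ × ℝ | x < max ω.2 0}).toReal = T phiG x := by
    intro x
    have : {ω : ℝ × ℝ | x < max ω.2 0} = univ ×ˢ {t : ℝ | x < max t 0} := by ext ω; simp
    rw [this, Measure.prod_prod, measure_univ, one_mul, hν, good_phiG.tail_max,
      ENNReal.toReal_ofReal (T_nonneg _ _)]
  have tXY : ∀ x y, ((μ.prod ν) {ω : ℝ × ℝ | x < max ω.1 0 ∧ y < max ω.2 0}).toReal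
      = T phiF x * T phiG y := by
    intro x y
    have : {ω : ℝ × ℝ | x < max ω.1 0 ∧ y < max ω.2 0}
        = {t : ℝ | x < max t 0} ×ˢ {t : ℝ | y < max t 0} := by ext ω; simp
    rw [this, Measure.prod_prod, hν, good_phiG.tail_max, hμ, good_phiF.tail_max, ENNReal.toReal_mul,
      ENNReal.toReal_ofReal (T_nonneg _ _), ENNReal.toReal_ofReal (T_nonneg _ _)]
  refine ⟨ℝ × ℝ, inferInstance, μ.prod ν, inferInstance, fun ω => max ω.1 0, fun ω => max ω.2 0,
    by fun_prop, by fun_prop, fun ω => le_max_right _ _, fun ω => le_max_right _ _,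
    indepFun_prod hm hm, ?_, ?_, ?_⟩
  · simp_rw [tX]; exact good_phiF.strong
  · simp_rw [tY]; exact good_phiG.strong
  · rw [part1 _ _ _ _ (fun ω => le_max_right _ _) (fun ω => le_max_right _ _)]
    exact not_strong _ _ _ _ (fun ω => le_max_right _ _) (fun ω => le_max_right _ _) tX tY tXY

end KLS

/-- For `A = {x : x₁/2 + x₂/2 > 1}` and independent nonnegative components `X₁, X₂` with
distributions in `𝒮*`, one has `F ∈ 𝒮*_A ↔ F₁ * F₂ ∈ 𝒮*` (the convolution tail being
`P[X₁ + X₂ > x]`); in particular, since `𝒮*` is not closed under convolution, there exist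
such `X₁, X₂` with `F ∉ 𝒮*_A`. -/
theorem statement19 :
    (∀ (Ω : Type) (_ : MeasurableSpace Ω) (P : Measure Ω), IsProbabilityMeasure P →
      ∀ X₁ X₂ : Ω → ℝ, Measurable X₁ → Measurable X₂ →
        (∀ ω, 0 ≤ X₁ ω) → (∀ ω, 0 ≤ X₂ ω) → IndepFun X₁ X₂ P →
        StrongSubexpFun (fun x => (P {ω | x < X₁ ω}).toReal) →
        StrongSubexpFun (fun x => (P {ω | x < X₂ ω}).toReal) →
        (StrongSubexpFun
            (tailYA P (fun ω => ![X₁ ω, X₂ ω])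
              {z : Fin 2 → ℝ | 1 < z 0 / 2 + z 1 / 2}) ↔
          StrongSubexpFun (fun x => (P {ω | x < X₁ ω + X₂ ω}).toReal))) ∧
    ∃ (Ω : Type) (_ : MeasurableSpace Ω) (P : Measure Ω) (_ : IsProbabilityMeasure P)
      (X₁ X₂ : Ω → ℝ), Measurable X₁ ∧ Measurable X₂ ∧
        (∀ ω, 0 ≤ X₁ ω) ∧ (∀ ω, 0 ≤ X₂ ω) ∧ IndepFun X₁ X₂ P ∧
        StrongSubexpFun (fun x => (P {ω | x < X₁ ω}).toReal) ∧
        StrongSubexpFun (fun x => (P {ω | x < X₂ ω}).toReal) ∧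
        ¬ StrongSubexpFun
            (tailYA P (fun ω => ![X₁ ω, X₂ ω])
              {z : Fin 2 → ℝ | 1 < z 0 / 2 + z 1 / 2}) := by
  exact ⟨fun Ω _ P _ X₁ X₂ _ _ h1 h2 _ _ _ => KLS.part1 Ω P X₁ X₂ h1 h2, KLS.part2⟩
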